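/- Let R be a commutative ring and M a finite free R-module of rank d with a chosen trivialization Δ = Λ^d M ≅ of the top exterior power. For 0 ≤ i ≤ d, the wedge pairing Λ^i M ⊗ Λ^{d-i} M → Λ^d M = Δ is a perfect pairing, inducing an isomorphism (Λ^i M)^∨ ≅ Λ^{d-i} M ⊗ Δ^{-1}. -/

import Mathlib

open Module Set Set.powersetCard in
theorem wedge_aux (R : Type*) [CommRing R] [Nontrivial R] (M : Type*) [AddCommGroup M] [Module R M]
    [Module.Free R M] [Module.Finite R M]
    (d i j : ℕ) (hd : Module.finrank R M = d) (hij : i + j = d)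
    (t : (⋀[R]^d M) ≃ₗ[R] R)
    (hm : ∀ (x : ⋀[R]^i M) (y : ⋀[R]^j M),
      (x : ExteriorAlgebra R M) * (y : ExteriorAlgebra R M) ∈ ⋀[R]^d M) :
    ∃ e : (⋀[R]^i M) ≃ₗ[R] Module.Dual R (⋀[R]^j M),
      ∀ (x : ⋀[R]^i M) (y : ⋀[R]^j M), e x y = t ⟨_, hm x y⟩ := by
  subst hij
  let b : Basis (Fin (i + j)) R M := Module.finBasisOfFinrankEq R M hd
  let f : (⋀[R]^i M) →ₗ[R] (⋀[R]^j M) →ₗ[R] (⋀[R]^(i + j) M) :=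
    LinearMap.mk₂ R (fun x y => ⟨_, hm x y⟩)
      (fun x x' y => by ext; simp [add_mul])
      (fun c x y => by ext; simp)
      (fun x y y' => by ext; simp [mul_add])
      (fun c x y => by ext; simp)
  have hf : ∀ x y, ((f x y : ⋀[R]^(i + j) M) : ExteriorAlgebra R M) = x * y := fun x y => rfl
  have htop : ∀ s s' : powersetCard (Fin (i + j)) (i + j), s = s' := by
    have key : ∀ s : powersetCard (Fin (i + j)) (i + j), s.1 = Finset.univ := fun s =>
      Finset.card_eq_iff_eq_univ _ |>.1 (by simp)
    intro s s'
    exact Subtype.ext ((key s).trans (key s').symm)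
  have hunit : ∀ s, IsUnit (t (b.exteriorPower (i + j) s)) := by
    intro s
    let : Unique (powersetCard (Fin (i + j)) (i + j)) := ⟨⟨s⟩, fun a => htop a s⟩
    have h1 := (b.exteriorPower (i + j)).sum_repr (t.symm 1)
    rw [Fintype.sum_unique] at h1
    have h2 := congrArg t h1
    rw [map_smul, LinearEquiv.apply_symm_apply, smul_eq_mul] at h2
    exact IsUnit.of_mul_eq_one_right _ h2
  have hc : j + i = Fintype.card (Fin (i + j)) := by simp [add_comm]
  let C : powersetCard (Fin (i + j)) i ≃ powersetCard (Fin (i + j)) j := powersetCard.compl hc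
  have hdiag : ∀ s, IsUnit (t (f (b.exteriorPower i s) (b.exteriorPower j (C s)))) := by
    intro s
    have hdis : Disjoint s.1 (C s).1 := by
      change Disjoint s.1 (s.1)ᶜ
      exact disjoint_compl_right
    have : f (b.exteriorPower i s) (b.exteriorPower j (C s)) =
        (permOfDisjoint hdis).sign • b.exteriorPower (i + j) (disjUnion hdis) := by
      apply Subtype.ext
      rw [hf, ← ExteriorAlgebra.basis_eq_coe_basis, ← ExteriorAlgebra.basis_eq_coe_basis,
        ExteriorAlgebra.basis_mul_of_disjoint b s (C s) hdis, ExteriorAlgebra.basis_eq_coe_basis]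
      rfl
    rw [this]
    have hu := hunit (disjUnion hdis)
    rcases Int.units_eq_one_or (permOfDisjoint hdis).sign with h | h <;> rw [h]
    · simpa using hu
    · simpa using hu
  have hoff : ∀ s u, C s ≠ u → f (b.exteriorPower i s) (b.exteriorPower j u) = 0 := by
    intro s u hne
    apply Subtype.ext
    rw [hf, ← ExteriorAlgebra.basis_eq_coe_basis, ← ExteriorAlgebra.basis_eq_coe_basis,
      ExteriorAlgebra.basis_mul_of_not_disjoint b s u]
    · rfl
    · intro hdis
      apply hne
      symm
      rw [eq_iff_subset]
      change u.1 ⊆ (s.1)ᶜ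
      intro a ha
      rw [Finset.mem_compl]
      exact fun h => Finset.disjoint_left.1 hdis h ha
  let D := ((b.exteriorPower j).dualBasis.reindex C.symm).unitsSMul (fun s => (hdiag s).unit)
  let e := (b.exteriorPower i).equiv D (Equiv.refl _)
  refine ⟨e, ?_⟩
  have : e.toLinearMap = f.compr₂ t.toLinearMap := by
    refine (b.exteriorPower i).ext fun s => (b.exteriorPower j).ext fun u => ?_
    have he : e (b.exteriorPower i s) = D s := (b.exteriorPower i).equiv_apply s D (Equiv.refl _)
    rw [LinearEquiv.coe_coe, he, LinearMap.compr₂_apply, LinearEquiv.coe_coe]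
    by_cases h : C s = u
    · subst h
      simp [D, Basis.unitsSMul_apply, Units.smul_def, -exteriorPower.coe_basis]
    · rw [hoff s u h]
      simp [D, Basis.unitsSMul_apply, Units.smul_def, -exteriorPower.coe_basis, h]
  intro x y
  exact congrArg (fun g => g x y) this

/-- Let `M` be a finite free module of rank `d` over a commutative ring `R`, with a
chosen trivialization `t : Λ^d M ≅ R` of the top exterior power.  For `0 ≤ i ≤ d`, the
wedge pairing `Λ^i M ⊗ Λ^{d-i} M → Λ^d M ≅ R` is perfect: the induced linear map
`Λ^i M → Hom(Λ^{d-i} M, R) = (Λ^{d-i} M)^∨` is an isomorphism (equivalently,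
`(Λ^i M)^∨ ≅ Λ^{d-i} M ⊗ Δ^{-1}`). -/
theorem exterior_power_wedge_pairing_perfect
    (R : Type*) [CommRing R] (M : Type*) [AddCommGroup M] [Module R M]
    [Module.Free R M] [Module.Finite R M]
    (d i : ℕ) (hd : Module.finrank R M = d) (hi : i ≤ d)
    (t : (⋀[R]^d M) ≃ₗ[R] R) :
    ∃ e : (⋀[R]^i M) ≃ₗ[R] Module.Dual R (⋀[R]^(d - i) M),
      ∀ (x : ⋀[R]^i M) (y : ⋀[R]^(d - i) M),
        e x y = t ⟨(x : ExteriorAlgebra R M) * (y : ExteriorAlgebra R M), by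
          have h := Submodule.mul_mem_mul x.2 y.2
          rw [← pow_add] at h
          rwa [Nat.add_sub_cancel' hi] at h⟩ := by
  have hm : ∀ (x : ⋀[R]^i M) (y : ⋀[R]^(d - i) M),
      (x : ExteriorAlgebra R M) * (y : ExteriorAlgebra R M) ∈ ⋀[R]^d M := by
    intro x y
    have h := Submodule.mul_mem_mul x.2 y.2
    rw [← pow_add] at h
    rwa [Nat.add_sub_cancel' hi] at h
  rcases subsingleton_or_nontrivial R with hR | hR
  · have : Subsingleton (⋀[R]^i M) := Module.subsingleton R _
    have : Subsingleton (Module.Dual R (⋀[R]^(d - i) M)) := Module.subsingleton R _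
    exact ⟨LinearEquiv.ofSubsingleton _ _, fun x y => Subsingleton.elim _ _⟩
  · exact wedge_aux R M d i (d - i) hd (Nat.add_sub_cancel' hi) t hm
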